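/- arXiv:math/0503434 — 3 statements merged into one kernel-verified Lean document; each statement's English description precedes it below -/
import Mathlib

section
/- (Proposition 1) Under assumptions (A4)–(A6), fix an open set O with Z ⊆ O and fix g > 0. Set w := min{1, g·d²·c₂²·c₁/(2·𝒦)} and t₀ := ⌊2H/(g·d²·c₂²·c₁)⌋ + 1. Then every (g,w)-admissible sequence z₀, z₁, …, z_{t₀} has non-empty intersection with O, i.e., z_t ∈ O for some 0 ≤ t ≤ t₀. -/
open MeasureTheory Filter Set

noncomputable section

namespace SA

/-- A sequence `z` is `(g, w)`-admissible (with respect to `φ`, the constants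
`ḡ = gbar`, `d`, `R`, `z^l = zl`, `z^r = zr` and the open set `O`) if
`|z₀| ≤ R` and there are sequences `(q_t)`, `(h_t)` with `|h_t| ≤ w`, such that
`g d² ≤ q_s ≤ ḡ` for `s = 0, …, t` whenever `{z₀, …, z_t} ⊆ [z^l, z^r] \ O`,
and `z_t = z_{t-1} - q_{t-1} φ(z_{t-1}) - h_t` for `t ≥ 1`. -/
def Admissible (φ : ℝ → ℝ) (gbar d R zl zr : ℝ) (O : Set ℝ)
    (g w : ℝ) (z : ℕ → ℝ) : Prop :=
  |z 0| ≤ R ∧ ∃ q h : ℕ → ℝ,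
    (∀ t, |h t| ≤ w) ∧
    (∀ t : ℕ, (∀ s ≤ t, z s ∈ Icc zl zr \ O) →
      ∀ s ≤ t, g * d ^ 2 ≤ q s ∧ q s ≤ gbar) ∧
    (∀ t : ℕ, 1 ≤ t → z t = z (t - 1) - q (t - 1) * φ (z (t - 1)) - h t)

/-- The descent inequality for a function with `M`-Lipschitz derivative. -/
lemma descent_le {f φ : ℝ → ℝ} {M : ℝ} (hf : ∀ x, HasDerivAt f (φ x) x)
    (hφ : ∀ x y, |φ y - φ x| ≤ M * |y - x|) (x v : ℝ) :
    f (x + v) ≤ f x + φ x * v + M / 2 * v ^ 2 := by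
  have hG (t : ℝ) : HasDerivAt (fun t => f (x + t * v) - t * (φ x * v) - M / 2 * v ^ 2 * t ^ 2)
      (φ (x + t * v) * v - φ x * v - M * v ^ 2 * t) t := by
    have h₁ : HasDerivAt (fun t : ℝ => x + t * v) v t := by
      simpa using ((hasDerivAt_id t).mul_const v).const_add x
    have h₂ := (hf (x + t * v)).comp t h₁
    have h₃ : HasDerivAt (fun t : ℝ => t * (φ x * v)) (φ x * v) t := by
      simpa using (hasDerivAt_id t).mul_const (φ x * v)
    have h₄ := (hasDerivAt_pow 2 t).const_mul (M / 2 * v ^ 2)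
    refine ((h₂.sub h₃).sub h₄).congr_deriv ?_
    norm_num
    ring
  have hanti := antitoneOn_of_deriv_nonpos (convex_Ici (0 : ℝ))
    (fun t _ => (hG t).continuousAt.continuousWithinAt)
    (fun t _ => (hG t).differentiableAt.differentiableWithinAt)
    (fun t ht => by
      rw [interior_Ici] at ht
      have ht : 0 < t := ht
      rw [(hG t).deriv]
      have h₁ := hφ x (x + t * v)
      rw [add_sub_cancel_left, abs_mul, abs_of_pos ht] at h₁
      have h₂ : (φ (x + t * v) - φ x) * v ≤ M * (t * |v|) * |v| := by
        refine (le_abs_self _).trans ?_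
        rw [abs_mul]
        gcongr
      have h₃ : |v| * |v| = v ^ 2 := by rw [← sq, sq_abs]
      linear_combination h₂ + M * t * h₃)
  have h := hanti (mem_Ici.2 le_rfl) (mem_Ici.2 zero_le_one) zero_le_one
  norm_num at h
  linarith

/-- A primitive of a function that is bounded away from zero and has the sign of `x` for
`|x| ≥ R` has bounded sublevel sets. -/
lemma sublevel_subset_Icc {f φ : ℝ → ℝ} {R a H : ℝ} (hf : ∀ x, HasDerivAt f (φ x) x)
    (hf0 : ∀ x, 0 ≤ f x) (ha : 0 < a) (hpos : ∀ x, R ≤ x → a ≤ φ x)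
    (hneg : ∀ x, x ≤ -R → φ x ≤ -a) :
    {x | f x ≤ H} ⊆ Icc (-(|R| + |H| / a)) (|R| + |H| / a) := by
  intro x hx
  have hx : f x ≤ H := hx
  have hdiff (D : Set ℝ) : DifferentiableOn ℝ f D :=
    fun t _ => (hf t).differentiableAt.differentiableWithinAt
  have hq : 0 ≤ |H| / a := by positivity
  have hRR := le_abs_self R
  have hHH := le_abs_self H
  refine ⟨?_, ?_⟩
  · rcases le_total (-R) x with h | h
    · linarith
    have := (convex_Iic (-R)).image_sub_le_mul_sub_of_deriv_le (hdiff _).continuousOn (hdiff _)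
      (C := -a) (fun t ht => by
        rw [(hf t).deriv]
        exact hneg t (mem_Iic.1 (interior_subset ht))) x h (-R) (mem_Iic.2 le_rfl) h
    have h₂ : -R - x ≤ |H| / a := by
      rw [le_div_iff₀ ha]
      linarith [hf0 (-R)]
    linarith
  · rcases le_total x R with h | h
    · linarith
    have := (convex_Ici R).mul_sub_le_image_sub_of_le_deriv (hdiff _).continuousOn (hdiff _)
      (C := a) (fun t ht => by
        rw [(hf t).deriv]
        exact hpos t (mem_Ici.1 (interior_subset ht))) R (mem_Ici.2 le_rfl) x h h
    have h₂ : x - R ≤ |H| / a := by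
      rw [le_div_iff₀ ha]
      linarith [hf0 R]
    linarith

/-- Proposition 1: under (A4)–(A6), with
`w = min{1, g d² c₂² c₁ / (2𝒦)}` and `t₀ = ⌊2H/(g d² c₂² c₁)⌋ + 1`, every
`(g, w)`-admissible sequence `z₀, …, z_{t₀}` meets the open set `O ⊇ Z`. -/
theorem admissible_meets_O (φ f : ℝ → ℝ) (u d gbar M R : ℝ)
    (hd0 : 0 < d) (hd1 : d < 1) (hu1 : 1 < u) (hg0 : 0 < gbar)
    -- (A4)
    (A4_smooth : ContDiff ℝ 1 φ)
    (A4_M : M = ⨆ x : ℝ, |deriv φ x|) (A4_bdd : ∀ x : ℝ, |deriv φ x| ≤ M)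
    -- (A5)
    (A5 : gbar < 2 / M)
    -- (A6)
    (hR : 0 < R) (A6a : ∀ x : ℝ, R ≤ |x| → 0 < x * φ x)
    (A6b : 0 < sInf ((fun x => φ x ^ 2) '' { x : ℝ | R ≤ |x| }))
    -- `f` is the primitive of `φ` with `inf f = 0`
    (hf : ∀ x : ℝ, HasDerivAt f (φ x) x)
    (hf_bdd : BddBelow (range f)) (hf0 : (⨅ x : ℝ, f x) = 0)
    -- the fixed open set `O ⊇ Z` and `g > 0`
    (O : Set ℝ) (hO : IsOpen O) (hZO : { x : ℝ | φ x = 0 } ⊆ O)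
    (g : ℝ) (hg : 0 < g)
    -- the constants of the construction
    (H c1 c2 c3 zl zr K w : ℝ) (t0 : ℕ)
    (hH : H = sSup (f '' Icc (-R) R))
    (hc1 : c1 = 1 - M * gbar / 2)
    (hc3 : c3 = gbar * sSup ((fun x => |φ x|) '' { x : ℝ | f x ≤ H }) + 1)
    (hzl : zl = sInf { x : ℝ | f x ≤ H } - c3)
    (hzr : zr = sSup { x : ℝ | f x ≤ H } + c3)
    (hc2 : c2 = sInf ((fun x => |φ x|) '' (Icc zl zr \ O)))
    (hK : K = sSup ((fun x => |φ x|) '' Icc zl zr))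
    (hw : w = min 1 (g * d ^ 2 * c2 ^ 2 * c1 / (2 * K)))
    (ht0 : t0 = ⌊2 * H / (g * d ^ 2 * c2 ^ 2 * c1)⌋₊ + 1) :
    ∀ z : ℕ → ℝ, Admissible φ gbar d R zl zr O g w z →
      ∃ t ≤ t0, z t ∈ O := by
  rintro z ⟨hz0, q, h, hh, hq, hrec⟩
  by_contra! hzO
  have hφc : Continuous φ := A4_smooth.continuous
  have hfc : Continuous f := continuous_iff_continuousAt.2 fun x => (hf x).continuousAt
  have hf_nonneg (x : ℝ) : 0 ≤ f x := hf0 ▸ ciInf_le hf_bdd x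
  have hM : 0 < M := by
    refine lt_of_le_of_ne ((abs_nonneg _).trans (A4_bdd 0)) fun hM => ?_
    rw [← hM, div_zero] at A5
    linarith
  have hc1_pos : 0 < c1 := by
    rw [lt_div_iff₀ hM] at A5
    rw [hc1]
    linarith
  have hLip (x y : ℝ) : |φ y - φ x| ≤ M * |y - x| :=
    convex_univ.norm_image_sub_le_of_norm_deriv_le
      (fun t _ => (A4_smooth.differentiable one_ne_zero) t) (fun t _ => A4_bdd t)
      (mem_univ x) (mem_univ y)
  set L : Set ℝ := {x | f x ≤ H}
  obtain ⟨B, hB⟩ : ∃ B, L ⊆ Icc (-B) B := by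
    set S := sInf ((fun x => φ x ^ 2) '' {x : ℝ | R ≤ |x|})
    have hsq (x : ℝ) (hx : R ≤ |x|) : √S ≤ |φ x| := by
      rw [← Real.sqrt_sq_eq_abs]
      exact Real.sqrt_le_sqrt (csInf_le ⟨0, by rintro _ ⟨y, -, rfl⟩; exact sq_nonneg _⟩
        (mem_image_of_mem (fun x => φ x ^ 2) hx))
    refine ⟨_, sublevel_subset_Icc (R := R) hf hf_nonneg (Real.sqrt_pos.2 A6b) ?_ ?_⟩
    · intro x hx
      have hx' : R ≤ |x| := hx.trans (le_abs_self x)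
      have := (pos_iff_pos_of_mul_pos (A6a x hx')).1 (hR.trans_le hx)
      simpa [abs_of_pos this] using hsq x hx'
    · intro x hx
      have hx' : R ≤ |x| := (le_neg_of_le_neg hx).trans (neg_le_abs x)
      have := (neg_iff_neg_of_mul_pos (A6a x hx')).1 (by linarith)
      have h₁ := hsq x hx'
      rw [abs_of_neg this] at h₁
      linarith
  have hc3_one : 1 ≤ c3 := by
    have : 0 ≤ sSup ((fun x => |φ x|) '' L) :=
      Real.sSup_nonneg (by rintro _ ⟨x, -, rfl⟩; exact abs_nonneg _)
    rw [hc3]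
    nlinarith
  have hLlow {x : ℝ} (hx : x ∈ L) : zl + 1 ≤ x := by
    have := csInf_le ⟨-B, fun y hy => (hB hy).1⟩ hx
    linarith
  have hLup {x : ℝ} (hx : x ∈ L) : x ≤ zr - 1 := by
    have := le_csSup ⟨B, fun y hy => (hB hy).2⟩ hx
    linarith
  have hLIcc {x : ℝ} (hx : x ∈ L) : x ∈ Icc zl zr :=
    ⟨by linarith [hLlow hx], by linarith [hLup hx]⟩
  have hz0L : f (z 0) ≤ H := by
    rw [hH]
    exact le_csSup (isCompact_Icc.image hfc).bddAbove (mem_image_of_mem f (abs_le.1 hz0))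
  have hc2_le {x : ℝ} (hx : x ∈ Icc zl zr \ O) : c2 ≤ |φ x| := by
    rw [hc2]
    exact csInf_le ⟨0, by rintro _ ⟨y, -, rfl⟩; exact abs_nonneg _⟩
      (mem_image_of_mem (fun x => |φ x|) hx)
  have hc2_pos : 0 < c2 := by
    obtain ⟨x, hx, hx'⟩ := ((isCompact_Icc.diff hO).image hφc.abs).sInf_mem
      (Nonempty.image _ ⟨z 0, hLIcc hz0L, hzO 0 (Nat.zero_le _)⟩)
    rw [hc2, ← hx']
    exact abs_pos.2 fun h0 => hx.2 (hZO h0)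
  have hK_le {x : ℝ} (hx : x ∈ Icc zl zr) : |φ x| ≤ K := by
    rw [hK]
    exact le_csSup (isCompact_Icc.image hφc.abs).bddAbove
      (mem_image_of_mem (fun x => |φ x|) hx)
  have hK_pos : 0 < K :=
    hc2_pos.trans_le ((hc2_le ⟨hLIcc hz0L, hzO 0 (Nat.zero_le _)⟩).trans (hK_le (hLIcc hz0L)))
  set δ := g * d ^ 2 * c2 ^ 2 * c1 with hδ
  have hδ_pos : 0 < δ := by positivity
  have hw1 : w ≤ 1 := hw ▸ min_le_left _ _
  have hKw : K * w ≤ δ / 2 := by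
    calc K * w ≤ K * (δ / (2 * K)) := by
          gcongr
          exact hw ▸ min_le_right _ _
      _ = δ / 2 := by field_simp
  have hstep (t : ℕ) (ht : ∀ s ≤ t, z s ∈ Icc zl zr \ O) (hft : f (z t) ≤ H) :
      f (z (t + 1)) ≤ f (z t) - δ / 2 := by
    obtain ⟨hq₁, hq₂⟩ := hq t ht t le_rfl
    have hz : z (t + 1) = z t + -(q t * φ (z t)) - h (t + 1) := by
      simpa [sub_eq_add_neg] using hrec (t + 1) (Nat.le_add_left 1 t)
    have hdesc : f (z t + -(q t * φ (z t))) ≤ f (z t) - δ := by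
      have h₁ := descent_le hf hLip (z t) (-(q t * φ (z t)))
      have h₂ : c2 ^ 2 ≤ φ (z t) ^ 2 := by
        rw [← sq_abs (φ (z t))]
        exact pow_le_pow_left₀ hc2_pos.le (hc2_le (ht t le_rfl)) 2
      have h₃ : c1 ≤ 1 - M * q t / 2 := by
        rw [hc1]
        nlinarith
      have hqt : 0 ≤ q t := le_trans (by positivity) hq₁
      have h₄ : δ ≤ q t * φ (z t) ^ 2 * (1 - M * q t / 2) := by
        rw [hδ]
        gcongr
      linear_combination h₁ + h₄
    set y := z t + -(q t * φ (z t))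
    have hyL : y ∈ L := by
      change f y ≤ H
      linarith
    have hht := hh (t + 1)
    obtain ⟨hh₁, hh₂⟩ := abs_le.1 (hht.trans hw1)
    have hmem : y - h (t + 1) ∈ Icc zl zr :=
      ⟨by linarith [hLlow hyL], by linarith [hLup hyL]⟩
    have hmv := (convex_Icc zl zr).norm_image_sub_le_of_norm_hasDerivWithin_le
      (fun x _ => (hf x).hasDerivWithinAt) (fun x hx => hK_le hx) (hLIcc hyL) hmem
    rw [sub_sub_cancel_left, norm_neg, Real.norm_eq_abs, Real.norm_eq_abs] at hmv
    have hKh : K * |h (t + 1)| ≤ K * w := by gcongr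
    rw [hz]
    linarith [le_abs_self (f (y - h (t + 1)) - f y)]
  have hbound (t : ℕ) (ht : t ≤ t0) : f (z t) ≤ H - t * (δ / 2) := by
    induction t using Nat.strong_induction_on with
    | _ t ih =>
      cases t with
      | zero => simpa using hz0L
      | succ t =>
        have hle (s : ℕ) (hs : s ≤ t) : f (z s) ≤ H := by
          have := ih s (by omega) (by omega)
          have : 0 ≤ (s : ℝ) * (δ / 2) := by positivity
          linarith
        have h₁ := hstep t (fun s hs => ⟨hLIcc (hle s hs), hzO s (by omega)⟩) (hle t le_rfl)
        have h₂ := ih t (by omega) (by omega)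
        push_cast
        linarith
  have hlt : 2 * H / δ < t0 := by
    rw [ht0]
    push_cast
    exact Nat.lt_floor_add_one _
  rw [div_lt_iff₀ hδ_pos] at hlt
  linarith [hbound t0 le_rfl, hf_nonneg (z t0)]

end SA
end
end

section
/- For every z ∈ ℝ one has 1/2 ≤ k₊(z) ≤ 1 and 0 ≤ k₋(z) ≤ k₊(z); moreover k₊(z) → 1 and k₋(z) → 1 as z → ∞. -/
open MeasureTheory ProbabilityTheory Filter Set Bornology

noncomputable section

namespace SA

/-- The set of achievable probabilities `P((φ₁+ξ₁)(φ₂+ξ₂) > 0)` over pairs of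
random variables `φ₁, φ₂` (on the same space as `ξ₁, ξ₂`) that are within `ε`
of `z` almost surely. -/
def probVals {Ω : Type*} [MeasurableSpace Ω] (μ : Measure Ω)
    (ξ₁ ξ₂ : Ω → ℝ) (z ε : ℝ) : Set ℝ :=
  { p | ∃ φ₁ φ₂ : Ω → ℝ, Measurable φ₁ ∧ Measurable φ₂ ∧
      (∀ᵐ ω ∂μ, |φ₁ ω - z| < ε ∧ |φ₂ ω - z| < ε) ∧
      p = (μ { ω | 0 < (φ₁ ω + ξ₁ ω) * (φ₂ ω + ξ₂ ω) }).toReal }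

/-- `k₊(z) = lim_{ε→0⁺} sup P((φ₁+ξ₁)(φ₂+ξ₂) > 0)`; since the inner `sup` is
monotone in `ε`, the right-sided limit is the infimum over `ε > 0`. -/
def kPlus {Ω : Type*} [MeasurableSpace Ω] (μ : Measure Ω)
    (ξ₁ ξ₂ : Ω → ℝ) (z : ℝ) : ℝ :=
  ⨅ ε : { e : ℝ // 0 < e }, sSup (probVals μ ξ₁ ξ₂ z ε.1)

/-- `k₋(z) = lim_{ε→0⁺} inf P((φ₁+ξ₁)(φ₂+ξ₂) > 0)`; since the inner `inf` is
antitone in `ε`, the right-sided limit is the supremum over `ε > 0`. -/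
def kMinus {Ω : Type*} [MeasurableSpace Ω] (μ : Measure Ω)
    (ξ₁ ξ₂ : Ω → ℝ) (z : ℝ) : ℝ :=
  ⨆ ε : { e : ℝ // 0 < e }, sInf (probVals μ ξ₁ ξ₂ z ε.1)

/-- `k = ln(1/d) / ln(u/d)`. -/
def kConst (u d : ℝ) : ℝ := Real.log (1 / d) / Real.log (u / d)

section

variable {Ω : Type*} [MeasurableSpace Ω] {μ : Measure Ω} {ξ₁ ξ₂ : Ω → ℝ} {z ε : ℝ}

lemma nonneg_of_mem_probVals {p : ℝ} (hp : p ∈ probVals μ ξ₁ ξ₂ z ε) : 0 ≤ p := by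
  obtain ⟨φ₁, φ₂, -, -, -, rfl⟩ := hp
  exact ENNReal.toReal_nonneg

lemma le_one_of_mem_probVals [IsProbabilityMeasure μ] {p : ℝ}
    (hp : p ∈ probVals μ ξ₁ ξ₂ z ε) : p ≤ 1 := by
  obtain ⟨φ₁, φ₂, -, -, -, rfl⟩ := hp
  exact measureReal_le_one

lemma bddBelow_probVals : BddBelow (probVals μ ξ₁ ξ₂ z ε) :=
  ⟨0, fun _ => nonneg_of_mem_probVals⟩

lemma bddAbove_probVals [IsProbabilityMeasure μ] : BddAbove (probVals μ ξ₁ ξ₂ z ε) :=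
  ⟨1, fun _ => le_one_of_mem_probVals⟩

/-- The constant perturbations `φ₁ = φ₂ = z` are always admissible. -/
lemma const_mem_probVals (hε : 0 < ε) :
    (μ {ω | 0 < (z + ξ₁ ω) * (z + ξ₂ ω)}).toReal ∈ probVals μ ξ₁ ξ₂ z ε :=
  ⟨fun _ => z, fun _ => z, measurable_const, measurable_const,
    ae_of_all _ fun _ => by simpa using hε, rfl⟩

lemma probVals_nonempty (hε : 0 < ε) : (probVals μ ξ₁ ξ₂ z ε).Nonempty :=
  ⟨_, const_mem_probVals hε⟩

lemma sSup_probVals_le_one [IsProbabilityMeasure μ] (hε : 0 < ε) :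
    sSup (probVals μ ξ₁ ξ₂ z ε) ≤ 1 :=
  csSup_le (probVals_nonempty hε) fun _ => le_one_of_mem_probVals

lemma sInf_probVals_le_one [IsProbabilityMeasure μ] (hε : 0 < ε) :
    sInf (probVals μ ξ₁ ξ₂ z ε) ≤ 1 :=
  (csInf_le bddBelow_probVals (const_mem_probVals hε)).trans
    (le_one_of_mem_probVals (const_mem_probVals hε))

/-- Pushing each `z + ξᵢ` away from zero makes its sign agree with the event `-z ≤ ξᵢ`, so that
two independent copies have equal signs with probability `p² + (1 - p)² ≥ 1 / 2`. -/
lemma exists_half_le_mem_probVals [IsProbabilityMeasure μ]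
    (hξ₁ : Measurable ξ₁) (hξ₂ : Measurable ξ₂)
    (hindep : IndepFun ξ₁ ξ₂ μ) (hident : IdentDistrib ξ₁ ξ₂ μ μ) (hε : 0 < ε) :
    ∃ p ∈ probVals μ ξ₁ ξ₂ z ε, 1 / 2 ≤ p := by
  let f : ℝ → ℝ := (Ici (-z)).piecewise (fun _ => z + ε / 2) (fun _ => z)
  have hf : Measurable f := Measurable.piecewise measurableSet_Ici measurable_const measurable_const
  have hf_pos (x : ℝ) (hx : -z ≤ x) : 0 < f x + x := by
    have : f x = z + ε / 2 := piecewise_eq_of_mem _ _ _ hx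
    linarith
  have hf_neg (x : ℝ) (hx : x < -z) : f x + x < 0 := by
    have : f x = z := piecewise_eq_of_notMem _ _ _ (by simpa using hx)
    linarith
  have hf_near (x : ℝ) : |f x - z| < ε := by
    by_cases hx : x ∈ Ici (-z)
    · have : f x = z + ε / 2 := piecewise_eq_of_mem _ _ _ hx
      rw [this, add_sub_cancel_left, abs_of_pos (by linarith)]
      linarith
    · have : f x = z := piecewise_eq_of_notMem _ _ _ hx
      simpa [this] using hε
  refine ⟨_, ⟨f ∘ ξ₁, f ∘ ξ₂, hf.comp hξ₁, hf.comp hξ₂,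
    ae_of_all _ fun ω => ⟨hf_near _, hf_near _⟩, rfl⟩, ?_⟩
  set p := μ.real (ξ₁ ⁻¹' Ici (-z)) with hp
  have hp₂ : μ.real (ξ₂ ⁻¹' Ici (-z)) = p := by
    simp only [hp, measureReal_def, hident.measure_mem_eq measurableSet_Ici]
  have hpc₁ : μ.real (ξ₁ ⁻¹' Iio (-z)) = 1 - p := by
    rw [← compl_Ici, preimage_compl, probReal_compl_eq_one_sub (hξ₁ measurableSet_Ici)]
  have hpc₂ : μ.real (ξ₂ ⁻¹' Iio (-z)) = 1 - p := by
    rw [← compl_Ici, preimage_compl, probReal_compl_eq_one_sub (hξ₂ measurableSet_Ici), hp₂]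
  have hprod (s : Set ℝ) (hs : MeasurableSet s) :
      μ.real (ξ₁ ⁻¹' s ∩ ξ₂ ⁻¹' s) = μ.real (ξ₁ ⁻¹' s) * μ.real (ξ₂ ⁻¹' s) := by
    simp only [measureReal_def, hindep.measure_inter_preimage_eq_mul s s hs hs, ENNReal.toReal_mul]
  have hdisj : Disjoint (ξ₁ ⁻¹' Ici (-z) ∩ ξ₂ ⁻¹' Ici (-z))
      (ξ₁ ⁻¹' Iio (-z) ∩ ξ₂ ⁻¹' Iio (-z)) :=
    Set.disjoint_left.2 fun ω h h' => not_lt_of_ge (show -z ≤ ξ₁ ω from h.1) h'.1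
  have hsub : ξ₁ ⁻¹' Ici (-z) ∩ ξ₂ ⁻¹' Ici (-z) ∪ ξ₁ ⁻¹' Iio (-z) ∩ ξ₂ ⁻¹' Iio (-z) ⊆
      {ω | 0 < ((f ∘ ξ₁) ω + ξ₁ ω) * ((f ∘ ξ₂) ω + ξ₂ ω)} := by
    rintro ω (h | h)
    · exact mul_pos (hf_pos _ h.1) (hf_pos _ h.2)
    · exact mul_pos_of_neg_of_neg (hf_neg _ h.1) (hf_neg _ h.2)
  calc (1 / 2 : ℝ) ≤ p * p + (1 - p) * (1 - p) := by nlinarith [sq_nonneg (2 * p - 1)]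
    _ = μ.real (ξ₁ ⁻¹' Ici (-z) ∩ ξ₂ ⁻¹' Ici (-z) ∪ ξ₁ ⁻¹' Iio (-z) ∩ ξ₂ ⁻¹' Iio (-z)) := by
      rw [measureReal_union hdisj ((hξ₁ measurableSet_Iio).inter (hξ₂ measurableSet_Iio)),
        hprod _ measurableSet_Ici, hprod _ measurableSet_Iio, hp₂, hpc₁, hpc₂]
    _ ≤ _ := measureReal_mono hsub

lemma half_le_kPlus [IsProbabilityMeasure μ] (hξ₁ : Measurable ξ₁) (hξ₂ : Measurable ξ₂)
    (hindep : IndepFun ξ₁ ξ₂ μ) (hident : IdentDistrib ξ₁ ξ₂ μ μ) :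
    1 / 2 ≤ kPlus μ ξ₁ ξ₂ z := by
  have : Nonempty {e : ℝ // 0 < e} := ⟨⟨1, one_pos⟩⟩
  refine le_ciInf fun ε => ?_
  obtain ⟨p, hp, hle⟩ := exists_half_le_mem_probVals (z := z) hξ₁ hξ₂ hindep hident ε.2
  exact hle.trans (le_csSup bddAbove_probVals hp)

lemma kPlus_le_one [IsProbabilityMeasure μ] : kPlus μ ξ₁ ξ₂ z ≤ 1 :=
  ciInf_le_of_le ⟨0, by rintro _ ⟨ε, rfl⟩; exact Real.sSup_nonneg fun _ => nonneg_of_mem_probVals⟩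
    ⟨1, one_pos⟩ (sSup_probVals_le_one one_pos)

lemma sInf_probVals_le_kMinus [IsProbabilityMeasure μ] (hε : 0 < ε) :
    sInf (probVals μ ξ₁ ξ₂ z ε) ≤ kMinus μ ξ₁ ξ₂ z :=
  le_ciSup (f := fun ε : {e : ℝ // 0 < e} => sInf (probVals μ ξ₁ ξ₂ z ε.1))
    ⟨1, by rintro _ ⟨ε, rfl⟩; exact sInf_probVals_le_one ε.2⟩ ⟨ε, hε⟩

lemma kMinus_nonneg [IsProbabilityMeasure μ] : 0 ≤ kMinus μ ξ₁ ξ₂ z :=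
  (Real.sInf_nonneg fun _ => nonneg_of_mem_probVals).trans (sInf_probVals_le_kMinus one_pos)

lemma kMinus_le_kPlus [IsProbabilityMeasure μ] : kMinus μ ξ₁ ξ₂ z ≤ kPlus μ ξ₁ ξ₂ z := by
  have : Nonempty {e : ℝ // 0 < e} := ⟨⟨1, one_pos⟩⟩
  exact ciSup_le fun ε => le_ciInf fun ε' =>
    (csInf_le bddBelow_probVals (const_mem_probVals ε.2)).trans
      (le_csSup bddAbove_probVals (const_mem_probVals ε'.2))

lemma measureReal_le_kMinus [IsProbabilityMeasure μ] :
    μ.real {ω | 1 - z < ξ₁ ω ∧ 1 - z < ξ₂ ω} ≤ kMinus μ ξ₁ ξ₂ z := by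
  refine le_trans (le_csInf (probVals_nonempty one_pos) ?_) (sInf_probVals_le_kMinus one_pos)
  rintro _ ⟨φ₁, φ₂, -, -, hφ, rfl⟩
  refine ENNReal.toReal_mono (measure_ne_top _ _) (measure_mono_ae ?_)
  filter_upwards [hφ] with ω hω h
  have h₁ := (abs_lt.1 hω.1).1
  have h₂ := (abs_lt.1 hω.2).1
  exact mul_pos (by linarith [h.1]) (by linarith [h.2])

lemma tendsto_measureReal_lt_and_lt [IsProbabilityMeasure μ] :
    Tendsto (fun z : ℝ => μ.real {ω | 1 - z < ξ₁ ω ∧ 1 - z < ξ₂ ω}) atTop (nhds 1) := by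
  have hmono : Monotone fun z : ℝ => {ω | 1 - z < ξ₁ ω ∧ 1 - z < ξ₂ ω} :=
    fun a b hab ω h => ⟨by linarith [h.1], by linarith [h.2]⟩
  have hunion : ⋃ z : ℝ, {ω | 1 - z < ξ₁ ω ∧ 1 - z < ξ₂ ω} = univ := by
    refine eq_univ_of_forall fun ω => mem_iUnion.2 ⟨2 - min (ξ₁ ω) (ξ₂ ω), ?_, ?_⟩
    · linarith [min_le_left (ξ₁ ω) (ξ₂ ω)]
    · linarith [min_le_right (ξ₁ ω) (ξ₂ ω)]
  have h := tendsto_measure_iUnion_atTop (μ := μ) hmono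
  rw [hunion, measure_univ] at h
  exact (ENNReal.tendsto_toReal ENNReal.one_ne_top).comp h

end

/-- For every `z`, `1/2 ≤ k₊(z) ≤ 1` and `0 ≤ k₋(z) ≤ k₊(z)`; moreover
`k₊(z) → 1` and `k₋(z) → 1` as `z → ∞`. -/
theorem kPlus_kMinus_bounds
    {Ω : Type*} [MeasurableSpace Ω] (μ : Measure Ω) [IsProbabilityMeasure μ]
    (ξ₁ ξ₂ : Ω → ℝ) (hξ₁ : Measurable ξ₁) (hξ₂ : Measurable ξ₂)
    (hindep : IndepFun ξ₁ ξ₂ μ) (hident : IdentDistrib ξ₁ ξ₂ μ μ) :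
    (∀ z : ℝ, 1 / 2 ≤ kPlus μ ξ₁ ξ₂ z ∧ kPlus μ ξ₁ ξ₂ z ≤ 1 ∧
      0 ≤ kMinus μ ξ₁ ξ₂ z ∧ kMinus μ ξ₁ ξ₂ z ≤ kPlus μ ξ₁ ξ₂ z) ∧
    Tendsto (kPlus μ ξ₁ ξ₂) atTop (nhds 1) ∧
    Tendsto (kMinus μ ξ₁ ξ₂) atTop (nhds 1) := by
  have hlim := tendsto_measureReal_lt_and_lt (μ := μ) (ξ₁ := ξ₁) (ξ₂ := ξ₂)
  refine ⟨fun z => ⟨half_le_kPlus hξ₁ hξ₂ hindep hident, kPlus_le_one, kMinus_nonneg,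
    kMinus_le_kPlus⟩, ?_, ?_⟩
  · exact tendsto_of_tendsto_of_tendsto_of_le_of_le hlim tendsto_const_nhds
      (fun z => measureReal_le_kMinus.trans kMinus_le_kPlus) fun z => kPlus_le_one
  · exact tendsto_of_tendsto_of_tendsto_of_le_of_le hlim tendsto_const_nhds
      (fun z => measureReal_le_kMinus) fun z => kMinus_le_kPlus.trans kPlus_le_one

end SA
end
end

section
/- Let ξ₁, ξ₂ be independent identically distributed real random variables with P(ξ₁ = x) = 0 for every x ∈ ℝ and P(ξ₁ > 0) = P(ξ₁ < 0) = 1/2, and suppose there exists L > 0 such that P(ξ₁ ∈ I) > 0 for every nonempty open interval I ⊆ [−L, L]. Then the function k(z) := P((z+ξ₁)(z+ξ₂) > 0) is continuous on ℝ, k(0) = 1/2 = inf_z k(z), and z = 0 is the unique global minimizer of k. -/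
open MeasureTheory ProbabilityTheory Filter Set

noncomputable section

namespace SA

/-- `k(z) = P((z+ξ₁)(z+ξ₂) > 0)`. -/
def kFun {Ω : Type*} [MeasurableSpace Ω] (μ : Measure Ω)
    (ξ₁ ξ₂ : Ω → ℝ) (z : ℝ) : ℝ :=
  (μ { ω | 0 < (z + ξ₁ ω) * (z + ξ₂ ω) }).toReal

/-- The distribution function of an atomless probability measure is continuous. -/
lemma continuous_cdf (ν : Measure ℝ) [IsProbabilityMeasure ν] (h : ∀ x, ν {x} = 0) :
    Continuous (cdf ν) := by
  refine continuous_iff_continuousAt.2 fun x => ?_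
  rw [(monotone_cdf ν).continuousAt_iff_leftLim_eq_rightLim, StieltjesFunction.rightLim_eq]
  have hx := h x
  rw [← measure_cdf ν, StieltjesFunction.measure_singleton, ENNReal.ofReal_eq_zero] at hx
  exact le_antisymm ((monotone_cdf ν).leftLim_le le_rfl) (by linarith)

/-- The distribution function strictly increases across an interval of positive mass. -/
lemma cdf_lt_cdf (ν : Measure ℝ) [IsProbabilityMeasure ν] {a b : ℝ} (h : 0 < ν (Ioo a b)) :
    cdf ν a < cdf ν b := by
  have hab := h.trans_le (measure_mono Ioo_subset_Ioc_self)
  rw [← measure_cdf ν, StieltjesFunction.measure_Ioc, ENNReal.ofReal_pos] at hab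
  linarith

/-- `k(z) = F(-z)² + (1 - F(-z))²`, where `F` is the common distribution function. -/
lemma kFun_eq_cdf {Ω : Type*} [MeasurableSpace Ω] (μ : Measure Ω) [IsProbabilityMeasure μ]
    (ξ₁ ξ₂ : Ω → ℝ) (hξ₁ : Measurable ξ₁) (hξ₂ : Measurable ξ₂)
    (hindep : IndepFun ξ₁ ξ₂ μ) (hident : IdentDistrib ξ₁ ξ₂ μ μ)
    (hatom : ∀ x : ℝ, μ.map ξ₁ {x} = 0) (z : ℝ) :
    kFun μ ξ₁ ξ₂ z = cdf (μ.map ξ₁) (-z) ^ 2 + (1 - cdf (μ.map ξ₁) (-z)) ^ 2 := by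
  have hprob : IsProbabilityMeasure (μ.map ξ₁) :=
    Measure.isProbabilityMeasure_map hξ₁.aemeasurable
  have hsq (s : Set ℝ) (hs : MeasurableSet s) :
      μ.real (ξ₁ ⁻¹' s ∩ ξ₂ ⁻¹' s) = (μ.map ξ₁).real s ^ 2 := by
    rw [measureReal_def, hindep.measure_inter_preimage_eq_mul s s hs hs,
      ← hident.measure_mem_eq hs, measureReal_def, Measure.map_apply hξ₁ hs,
      ENNReal.toReal_mul, sq]
  have hset : {ω | 0 < (z + ξ₁ ω) * (z + ξ₂ ω)} =
      (ξ₁ ⁻¹' Iio (-z) ∩ ξ₂ ⁻¹' Iio (-z)) ∪ (ξ₁ ⁻¹' Ioi (-z) ∩ ξ₂ ⁻¹' Ioi (-z)) := by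
    ext ω
    simp only [mem_ofPred_eq, mul_pos_iff, mem_union, mem_inter_iff, mem_preimage, mem_Iio,
      mem_Ioi, neg_lt_iff_pos_add', lt_neg_iff_add_neg']
    tauto
  have hdisj : Disjoint (ξ₁ ⁻¹' Iio (-z) ∩ ξ₂ ⁻¹' Iio (-z))
      (ξ₁ ⁻¹' Ioi (-z) ∩ ξ₂ ⁻¹' Ioi (-z)) :=
    disjoint_left.2 fun _ h₁ h₂ =>
      lt_asymm (mem_Iio.1 (mem_preimage.1 h₁.1)) (mem_Ioi.1 (mem_preimage.1 h₂.1))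
  have hIio : (μ.map ξ₁).real (Iio (-z)) = cdf (μ.map ξ₁) (-z) := by
    have : NullSingletonClass (μ.map ξ₁) := ⟨hatom⟩
    rw [cdf_eq_real, measureReal_congr Iio_ae_eq_Iic]
  have hIoi : (μ.map ξ₁).real (Ioi (-z)) = 1 - cdf (μ.map ξ₁) (-z) := by
    rw [cdf_eq_real, ← compl_Iic, probReal_compl_eq_one_sub measurableSet_Iic]
  rw [kFun, hset, ← measureReal_def, measureReal_union hdisj
    ((hξ₁ measurableSet_Ioi).inter (hξ₂ measurableSet_Ioi)), hsq _ measurableSet_Iio,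
    hsq _ measurableSet_Ioi, hIio, hIoi]

/-- If `ξ₁, ξ₂` are i.i.d. with atomless common distribution,
`P(ξ₁ > 0) = P(ξ₁ < 0) = 1/2`, and every nonempty open subinterval of
`[-L, L]` has positive mass, then `k(z) = P((z+ξ₁)(z+ξ₂) > 0)` is continuous,
`k(0) = 1/2 = inf_z k(z)`, and `z = 0` is the unique global minimizer. -/
theorem kFun_properties
    {Ω : Type*} [MeasurableSpace Ω] (μ : Measure Ω) [IsProbabilityMeasure μ]
    (ξ₁ ξ₂ : Ω → ℝ) (hξ₁ : Measurable ξ₁) (hξ₂ : Measurable ξ₂)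
    (hindep : IndepFun ξ₁ ξ₂ μ) (hident : IdentDistrib ξ₁ ξ₂ μ μ)
    (hatom : ∀ x : ℝ, μ { ω | ξ₁ ω = x } = 0)
    (hpos : μ { ω | 0 < ξ₁ ω } = 1 / 2)
    (hneg : μ { ω | ξ₁ ω < 0 } = 1 / 2)
    (L : ℝ) (hL : 0 < L)
    (hsupp : ∀ a b : ℝ, -L ≤ a → a < b → b ≤ L →
      0 < μ { ω | a < ξ₁ ω ∧ ξ₁ ω < b }) :
    Continuous (kFun μ ξ₁ ξ₂) ∧
    kFun μ ξ₁ ξ₂ 0 = 1 / 2 ∧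
    (⨅ z : ℝ, kFun μ ξ₁ ξ₂ z) = 1 / 2 ∧
    (∀ z : ℝ, kFun μ ξ₁ ξ₂ 0 ≤ kFun μ ξ₁ ξ₂ z) ∧
    (∀ z : ℝ, z ≠ 0 → kFun μ ξ₁ ξ₂ 0 < kFun μ ξ₁ ξ₂ z) := by
  have hprob : IsProbabilityMeasure (μ.map ξ₁) :=
    Measure.isProbabilityMeasure_map hξ₁.aemeasurable
  have hatom' (x : ℝ) : μ.map ξ₁ {x} = 0 := by
    rw [Measure.map_apply hξ₁ (measurableSet_singleton x)]
    exact hatom x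
  have hk := kFun_eq_cdf μ ξ₁ ξ₂ hξ₁ hξ₂ hindep hident hatom'
  have hF0 : cdf (μ.map ξ₁) 0 = 1 / 2 := by
    have hIoi : (μ.map ξ₁).real (Ioi 0) = 1 / 2 := by
      rw [map_measureReal_apply hξ₁ measurableSet_Ioi, measureReal_def]
      change (μ {ω | 0 < ξ₁ ω}).toReal = 1 / 2
      rw [hpos]
      norm_num
    rw [cdf_eq_real, ← compl_Ioi, probReal_compl_eq_one_sub measurableSet_Ioi, hIoi]
    norm_num
  have hlt (a b : ℝ) (ha : -L ≤ a) (hab : a < b) (hb : b ≤ L) :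
      cdf (μ.map ξ₁) a < cdf (μ.map ξ₁) b := by
    refine cdf_lt_cdf _ ?_
    rw [Measure.map_apply hξ₁ measurableSet_Ioo]
    exact hsupp a b ha hab hb
  have hne (x : ℝ) (hx : x ≠ 0) : cdf (μ.map ξ₁) x ≠ 1 / 2 := by
    rcases lt_or_gt_of_ne hx with hx | hx
    · have h₁ := monotone_cdf (μ.map ξ₁) (le_max_left x (-L))
      have h₂ := hlt (max x (-L)) 0 (le_max_right _ _) (max_lt hx (by linarith)) hL.le
      linarith
    · have h₁ := monotone_cdf (μ.map ξ₁) (min_le_left x L)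
      have h₂ := hlt 0 (min x L) (by linarith) (lt_min hx hL) (min_le_right _ _)
      linarith
  have hk0 : kFun μ ξ₁ ξ₂ 0 = 1 / 2 := by
    rw [hk, neg_zero, hF0]
    norm_num
  have hmin (z : ℝ) : kFun μ ξ₁ ξ₂ 0 ≤ kFun μ ξ₁ ξ₂ z := by
    rw [hk0, hk]
    nlinarith [sq_nonneg (cdf (μ.map ξ₁) (-z) - 1 / 2)]
  refine ⟨?_, hk0, ?_, hmin, fun z hz => ?_⟩
  · have hcont := continuous_cdf (μ.map ξ₁) hatom'
    rw [funext hk]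
    fun_prop
  · rw [← hk0]
    exact le_antisymm (ciInf_le ⟨_, forall_mem_range.2 hmin⟩ 0) (le_ciInf hmin)
  · rw [hk0, hk]
    have h := sub_ne_zero.2 (hne (-z) (neg_ne_zero.2 hz))
    nlinarith [sq_pos_of_ne_zero h]

end SA
end
end
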